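/- Let F be a field, and fix integers m ≥ 2, ℓ ≥ 1, s ≥ 1, r_1,…,r_m ≥ 1 with k = mℓ − s ≥ ℓ and n = Σ_{i=1}^m (ℓ + r_i). Suppose G' ∈ F^{k×(n−1)}, written in blocks (B_1 | … | B_{m−1} | B'_m) with B_i ∈ F^{k×(ℓ+r_i)} for i < m and B'_m ∈ F^{k×(ℓ+r_m−1)}, satisfies the PMDS condition for the parameters (ℓ; r_1,…,r_{m−1}, r_m − 1). Let C_m ∈ F^{k×ℓ} consist of the first ℓ columns of B'_m, with columns C_m^{(1)},…,C_m^{(ℓ)}. Form the matrix G(y) over the polynomial ring F[y_1,…,y_ℓ] by appending to the last block the column Σ_{t=1}^ℓ y_t C_m^{(t)}. Then the product, over all k-element column-index sets S of G(y) containing at most ℓ indices from each of the m blocks, of det of the corresponding k×k submatrix, has total degree at most M(k−1; ℓ+r_1,…,ℓ+r_{m−1}, ℓ+r_m−1; ℓ,…,ℓ,ℓ−1). -/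

import Mathlib

/-- The block condition with locality `ℓ` on a matrix `G` whose columns are grouped into
`m` blocks, block `i` having `nb i` columns: every `k × k` submatrix of `G` formed by
choosing `k` distinct columns, at most `ℓ` of them from each block, is invertible.
For block sizes `nb i = ℓ + r i` this is the PMDS condition for `(ℓ; r_1, …, r_m)`. -/
def BlockCond (F : Type*) [CommRing F] {k m : ℕ} (ℓ : ℕ) (nb : Fin m → ℕ)
    (G : Matrix (Fin k) ((i : Fin m) × Fin (nb i)) F) : Prop :=
  ∀ e : Fin k → (i : Fin m) × Fin (nb i), Function.Injective e →
    (∀ i : Fin m, (Finset.univ.filter (fun b => (e b).1 = i)).card ≤ ℓ) →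
    IsUnit (Matrix.det (Matrix.of fun a b => G a (e b)))

/-- The determinant of the `k × k` submatrix of `M` formed by the columns in a
`k`-element set `S` (via some enumeration of `S`; determinants for different
enumerations agree up to sign). -/
noncomputable def subDet {R : Type*} [CommRing R] {k : ℕ} {ι : Type*}
    (M : Matrix (Fin k) ι R) (S : Finset ι) (hS : S.card = k) : R :=
  Matrix.det (Matrix.of fun a b => M a ((S.equivFinOfCardEq hS).symm b).1)

/-- `Mcount k nb f` is the number of `k`-element subsets `I` of the disjoint union of
blocks `J_1, …, J_m` (block `i` having `nb i` elements) with `|I ∩ J_i| ≤ f i` for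
every `i`. This is the quantity `M(k; n_1, …, n_m; f_1, …, f_m)`. -/
def Mcount (k : ℕ) {m : ℕ} (nb f : Fin m → ℕ) : ℕ :=
  ((Finset.powersetCard k (Finset.univ : Finset ((i : Fin m) × Fin (nb i)))).filter
    (fun I => ∀ i : Fin m, (I.filter (fun c => c.1 = i)).card ≤ f i)).card

/-- Given a matrix `G'` with blocks of sizes `nb' i ≤ ℓ + r i` (and `ℓ ≤ nb' i`),
form the matrix over `F[y_1, …, y_ℓ]` with blocks of sizes `ℓ + r i` whose columns in
position `< nb' i` are the (constant) columns of `G'` and whose remaining columns are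
`∑_t y_t C_i^{(t)}`, with `C_i^{(t)}` the `t`-th column of the `i`-th block of `G'`. -/
noncomputable def appendCols {F : Type*} [Field F] {m ℓ k : ℕ} (r nb' : Fin m → ℕ)
    (hℓnb : ∀ i, ℓ ≤ nb' i)
    (G' : Matrix (Fin k) ((i : Fin m) × Fin (nb' i)) F) :
    Matrix (Fin k) ((i : Fin m) × Fin (ℓ + r i)) (MvPolynomial (Fin ℓ) F) :=
  Matrix.of fun a c =>
    if h : c.2.1 < nb' c.1 then MvPolynomial.C (G' a ⟨c.1, ⟨c.2.1, h⟩⟩)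
    else ∑ t : Fin ℓ,
      MvPolynomial.X t *
        MvPolynomial.C (G' a ⟨c.1, ⟨t.1, lt_of_lt_of_le t.isLt (hℓnb c.1)⟩⟩)

/-- If every entry in column `b` has total degree at most `d b`, then the determinant has
total degree at most `∑ b, d b`. -/
theorem MvPolynomial.totalDegree_det_le_sum {R σ n : Type*} [CommRing R] [Fintype n]
    [DecidableEq n] (M : Matrix n n (MvPolynomial σ R)) (d : n → ℕ)
    (hM : ∀ a b, (M a b).totalDegree ≤ d b) :
    M.det.totalDegree ≤ ∑ b, d b := by
  rw [Matrix.det_apply]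
  refine MvPolynomial.totalDegree_finsetSum_le fun τ _ => ?_
  refine (MvPolynomial.totalDegree_smul_le _ _).trans ?_
  exact (MvPolynomial.totalDegree_finsetProd _ _).trans
    (Finset.sum_le_sum fun b _ => hM (τ b) b)

theorem totalDegree_subDet_le_sum {R σ ι : Type*} [CommRing R] {k : ℕ}
    (M : Matrix (Fin k) ι (MvPolynomial σ R)) (d : ι → ℕ)
    (hM : ∀ a c, (M a c).totalDegree ≤ d c) (S : Finset ι) (hS : S.card = k) :
    (subDet M S hS).totalDegree ≤ ∑ c ∈ S, d c := by
  refine (MvPolynomial.totalDegree_det_le_sum _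
    (fun b => d ((S.equivFinOfCardEq hS).symm b).1) fun a b => hM _ _).trans ?_
  rw [Equiv.sum_comp (S.equivFinOfCardEq hS).symm (fun c : S => d c.1),
    Finset.sum_coe_sort S d]

theorem totalDegree_appendCols_le {F : Type*} [Field F] {m ℓ k : ℕ} (r nb' : Fin m → ℕ)
    (hℓnb : ∀ i, ℓ ≤ nb' i) (G' : Matrix (Fin k) ((i : Fin m) × Fin (nb' i)) F)
    (a : Fin k) (c : (i : Fin m) × Fin (ℓ + r i)) :
    (appendCols r nb' hℓnb G' a c).totalDegree ≤ if c.2.1 < nb' c.1 then 0 else 1 := by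
  simp only [appendCols, Matrix.of_apply]
  split_ifs with h
  · simp
  · refine MvPolynomial.totalDegree_finsetSum_le fun t _ => ?_
    refine (MvPolynomial.totalDegree_mul _ _).trans ?_
    simp

/-- Removing a distinguished element `c₀` of the block `i₀` embeds the `k`-sets through `c₀`
respecting the bounds `f` into the `(k - 1)`-sets respecting the bounds lowered by one at `i₀`. -/
theorem card_filter_mem_le_Mcount {m k : ℕ} (nb nb' f f' : Fin m → ℕ)
    (c₀ : (i : Fin m) × Fin (nb i)) (hle : ∀ i, nb' i ≤ nb i)
    (hc₀ : ∀ c : (i : Fin m) × Fin (nb i), c.2.1 < nb' c.1 ↔ c ≠ c₀)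
    (hf' : f' c₀.1 = f c₀.1 - 1) (hf : ∀ i, i ≠ c₀.1 → f' i = f i) :
    (((Finset.powersetCard k (Finset.univ : Finset ((i : Fin m) × Fin (nb i)))).filter
        (fun I => ∀ i : Fin m, (I.filter (fun c => c.1 = i)).card ≤ f i)).filter
          (fun S => c₀ ∈ S)).card ≤ Mcount (k - 1) nb' f' := by
  classical
  let g : ((i : Fin m) × Fin (nb' i)) ↪ ((i : Fin m) × Fin (nb i)) :=
    Function.Embedding.sigmaMap (Function.Embedding.refl _) fun i => Fin.castLEEmb (hle i)
  have hmap : ∀ S : Finset ((i : Fin m) × Fin (nb i)),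
      (Finset.univ.filter (fun d => g d ∈ S)).map g = S.erase c₀ := by
    intro S
    ext c
    simp only [Finset.mem_map, Finset.mem_filter, Finset.mem_univ, true_and, Finset.mem_erase]
    constructor
    · rintro ⟨d, hd, rfl⟩
      exact ⟨(hc₀ _).1 d.2.2, hd⟩
    · rintro ⟨hc, hS⟩
      exact ⟨⟨c.1, c.2.1, (hc₀ c).2 hc⟩, hS, rfl⟩
  refine Finset.card_le_card_of_injOn (fun S => Finset.univ.filter (fun d => g d ∈ S)) ?_ ?_
  · intro S hS
    simp only [Finset.coe_filter, Finset.mem_filter, Finset.mem_powersetCard, Set.mem_ofPred_eq,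
      Finset.subset_univ, true_and] at hS ⊢
    obtain ⟨⟨hcard, hblock⟩, hmem⟩ := hS
    refine ⟨?_, fun i => ?_⟩
    · rw [← Finset.card_map g, hmap, Finset.card_erase_of_mem hmem, hcard]
    · have hcount : ((Finset.univ.filter (fun d => g d ∈ S)).filter (fun d => d.1 = i)).card
          = ((S.erase c₀).filter (fun c => c.1 = i)).card := by
        rw [← hmap S, Finset.filter_map, Finset.card_map]
        rfl
      rw [hcount, Finset.filter_erase]
      by_cases hi : i = c₀.1
      · subst hi
        rw [Finset.card_erase_of_mem (by simp [hmem]), hf']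
        exact Nat.sub_le_sub_right (hblock _) 1
      · rw [hf i hi]
        exact (Finset.card_le_card (Finset.erase_subset _ _)).trans (hblock i)
  · intro S hS T hT hST
    simp only [Finset.coe_filter, Set.mem_ofPred_eq] at hS hT
    rw [← Finset.insert_erase hS.2, ← Finset.insert_erase hT.2, ← hmap S, ← hmap T]
    exact congrArg (fun U => insert c₀ (U.map g)) hST

/-- Let `G'` satisfy the PMDS condition for the parameters
`(ℓ; r_1, …, r_{m−1}, r_m − 1)` (block sizes `nb' i`, equal to `ℓ + r i` except
`ℓ + r_m − 1` for the last block). Append to the last block the column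
`∑_t y_t C_m^{(t)}`, obtaining `G(y)` over `F[y_1, …, y_ℓ]`. Then the product, over all
`k`-element column sets `S` with at most `ℓ` indices per block, of `det` of the
corresponding `k × k` submatrix of `G(y)` has total degree at most
`M(k−1; ℓ+r_1, …, ℓ+r_{m−1}, ℓ+r_m−1; ℓ, …, ℓ, ℓ−1)`. -/
theorem pmds_step_degree_bound (F : Type*) [Field F]
    (m ℓ s k : ℕ) (r : Fin m → ℕ)
    (hm : 2 ≤ m) (hℓ : 1 ≤ ℓ) (hs : 1 ≤ s) (hr : ∀ i, 1 ≤ r i)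
    (hk : k + s = m * ℓ) (hℓk : ℓ ≤ k)
    (nb' : Fin m → ℕ)
    (hnb' : ∀ i, nb' i = if i.1 = m - 1 then ℓ + r i - 1 else ℓ + r i)
    (G' : Matrix (Fin k) ((i : Fin m) × Fin (nb' i)) F)
    (hG' : BlockCond F ℓ nb' G') :
    (∏ S ∈ ((Finset.powersetCard k
          (Finset.univ : Finset ((i : Fin m) × Fin (ℓ + r i)))).filter
            (fun I => ∀ i : Fin m, (I.filter (fun c => c.1 = i)).card ≤ ℓ)).attach,
        subDet
          (appendCols r nb'
            (fun i => by have h1 := hr i; rw [hnb' i]; split <;> omega) G')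
          S.1 (Finset.mem_powersetCard.mp (Finset.mem_filter.mp S.2).1).2).totalDegree
      ≤ Mcount (k - 1) nb' (fun i => if i.1 = m - 1 then ℓ - 1 else ℓ) := by
  classical
  have hrm := hr ⟨m - 1, by omega⟩
  let c₀ : (i : Fin m) × Fin (ℓ + r i) :=
    ⟨⟨m - 1, by omega⟩, ⟨ℓ + r ⟨m - 1, by omega⟩ - 1, by omega⟩⟩
  have hc₀ : ∀ c : (i : Fin m) × Fin (ℓ + r i), c.2.1 < nb' c.1 ↔ c ≠ c₀ := by
    rintro ⟨i, j⟩
    have hj := j.2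
    rw [hnb' i]
    by_cases hi : i.1 = m - 1
    · obtain ⟨i, hi'⟩ := i
      dsimp only at hi hj ⊢
      subst hi
      simp only [if_true, c₀, ne_eq, Sigma.mk.injEq, heq_eq_eq, true_and, Fin.ext_iff]
      omega
    · simp only [hi, if_false, j.2, true_iff]
      intro h
      exact hi (congrArg (fun c : (i : Fin m) × Fin (ℓ + r i) => c.1.1) h)
  refine (MvPolynomial.totalDegree_finsetProd _ _).trans ?_
  refine le_trans ?_ (card_filter_mem_le_Mcount (fun i => ℓ + r i) nb' (fun _ => ℓ) _ c₀
    (fun i => by rw [hnb' i]; split <;> omega) hc₀ (by simp [c₀])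
    fun i hi => if_neg fun h => hi (Fin.ext h))
  rw [Finset.card_filter]
  conv_rhs => rw [← Finset.sum_attach]
  refine Finset.sum_le_sum fun S _ => ?_
  refine (totalDegree_subDet_le_sum _ _ (totalDegree_appendCols_le r nb' _ G') _ _).trans ?_
  have hd : ∀ c : (i : Fin m) × Fin (ℓ + r i),
      (if c.2.1 < nb' c.1 then 0 else 1) = if c₀ = c then 1 else 0 := by
    intro c
    simp only [hc₀, ne_eq, ite_not, eq_comm]
  simp only [hd, Finset.sum_ite_eq, le_refl]
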